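/- arXiv:1209.6258 — 3 statements merged into one kernel-verified Lean document; each statement's English description precedes it below -/
import Mathlib

section
/- Let Q be an affine monoid, let q, p_1, …, p_l ∈ gp(Q) and let F, G_1, …, G_l be (not necessarily distinct) faces of Q. If F + q ⊆ ⋃_{i=1}^{l} (gp(G_i) + p_i), then there exists an index i with F + q ⊆ gp(G_i) + p_i. -/
open scoped Pointwise

/-- The lattice `ℤ^N`. -/
abbrev ZN (N : ℕ) : Type := Fin N → ℤ

/-- The subgroup of `ℤ^N` generated by a submonoid `Q`, i.e. `gp(Q)`. -/
def gp {N : ℕ} (Q : AddSubmonoid (ZN N)) : AddSubgroup (ZN N) :=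
  AddSubgroup.closure (Q : Set (ZN N))

/-- `F` is a face of the monoid `Q`. -/
def IsFace {N : ℕ} (Q F : AddSubmonoid (ZN N)) : Prop :=
  F ≤ Q ∧ ∀ a b : ZN N, a ∈ Q → b ∈ Q → (a + b ∈ F ↔ a ∈ F ∧ b ∈ F)

/-- The normalization (saturation) `sat(Q)` of `Q`:
all `q ∈ gp(Q)` such that `n • q ∈ Q` for some `n ≥ 1`. -/
def sat {N : ℕ} (Q : AddSubmonoid (ZN N)) : AddSubmonoid (ZN N) where
  carrier := {q | q ∈ gp Q ∧ ∃ n : ℕ, 1 ≤ n ∧ n • q ∈ Q}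
  zero_mem' := ⟨(gp Q).zero_mem, 1, le_refl 1, by simpa using Q.zero_mem⟩
  add_mem' := by
    rintro a b ⟨ha, n, hn, hna⟩ ⟨hb, m, hm, hmb⟩
    refine ⟨(gp Q).add_mem ha hb, n * m,
      Nat.one_le_iff_ne_zero.mpr (Nat.mul_ne_zero (by omega) (by omega)), ?_⟩
    have h1 : (n * m) • a ∈ Q := by
      rw [mul_comm, mul_smul]; exact AddSubmonoid.nsmul_mem Q hna m
    have h2 : (n * m) • b ∈ Q := by
      rw [mul_smul]; exact AddSubmonoid.nsmul_mem Q hmb n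
    rw [smul_add]; exact Q.add_mem h1 h2

/-- `Q` is contained in its normalization. -/
theorem le_sat {N : ℕ} (Q : AddSubmonoid (ZN N)) : Q ≤ sat Q := fun q hq =>
  ⟨AddSubgroup.subset_closure hq, 1, le_refl 1, by simpa using hq⟩

/-- The set of holes `sat(Q) ∖ Q`. -/
def holes {N : ℕ} (Q : AddSubmonoid (ZN N)) : Set (ZN N) :=
  (sat Q : Set (ZN N)) \ (Q : Set (ZN N))

/-- The localization `Q_F = {q - f : q ∈ Q, f ∈ F}`. -/
def loc {N : ℕ} (Q F : AddSubmonoid (ZN N)) : AddSubmonoid (ZN N) where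
  carrier := {x | ∃ q ∈ Q, ∃ f ∈ F, x = q - f}
  zero_mem' := ⟨0, Q.zero_mem, 0, F.zero_mem, by simp⟩
  add_mem' := by
    rintro a b ⟨q, hq, f, hf, rfl⟩ ⟨q', hq', f', hf', rfl⟩
    exact ⟨q + q', Q.add_mem hq hq', f + f', F.add_mem hf hf', by ring⟩

/-- `F` is a maximal face (w.r.t. inclusion) among the faces `G` of `Q` with
`G + m ⊆ D`. -/
def IsMaxFaceFor {N : ℕ} (Q : AddSubmonoid (ZN N)) (D : Set (ZN N))
    (F : AddSubmonoid (ZN N)) (m : ZN N) : Prop :=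
  IsFace Q F ∧ (∀ f ∈ F, f + m ∈ D) ∧
    ∀ G : AddSubmonoid (ZN N), IsFace Q G → (∀ g ∈ G, g + m ∈ D) → F ≤ G → G = F

/-- `gp(F) + q` is a family of holes of `Q` (with the face `F` and base point `q`). -/
def IsFamilyOfHolesWith {N : ℕ} (Q F : AddSubmonoid (ZN N)) (q : ZN N) : Prop :=
  q ∈ holes Q ∧ IsMaxFaceFor Q (holes Q) F q

/-- `S ⊆ gp(Q)` is a family of holes of `Q`. -/
def IsFamilyOfHoles {N : ℕ} (Q : AddSubmonoid (ZN N)) (S : Set (ZN N)) : Prop :=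
  ∃ (q : ZN N) (F : AddSubmonoid (ZN N)), IsFamilyOfHolesWith Q F q ∧
    S = (fun f => f + q) '' (gp F : Set (ZN N))

/-- `M ⊆ gp(Q)` is a `Q`-module. -/
def IsQModule {N : ℕ} (Q : AddSubmonoid (ZN N)) (M : Set (ZN N)) : Prop :=
  M ⊆ (gp Q : Set (ZN N)) ∧ ∀ q ∈ Q, ∀ m ∈ M, q + m ∈ M

/-- `M` is a finitely generated `Q`-module: a finite union of translates of `Q`. -/
def IsFGQModule {N : ℕ} (Q : AddSubmonoid (ZN N)) (M : Set (ZN N)) : Prop :=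
  IsQModule Q M ∧ ∃ s : Finset (ZN N), ↑s ⊆ M ∧
    M = ⋃ m ∈ s, {x | ∃ q ∈ Q, x = m + q}

/-- The rank of a subgroup of `ℤ^N`. -/
noncomputable def rk {N : ℕ} (A : AddSubgroup (ZN N)) : ℕ :=
  Module.finrank ℤ (AddSubgroup.toIntSubmodule A)

/-- The face `F₀` of units of `Q`. -/
def unitsFace {N : ℕ} (Q : AddSubmonoid (ZN N)) : AddSubmonoid (ZN N) where
  carrier := {q | q ∈ Q ∧ -q ∈ Q}
  zero_mem' := ⟨Q.zero_mem, by simpa using Q.zero_mem⟩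
  add_mem' := by
    rintro a b ⟨ha, ha'⟩ ⟨hb, hb'⟩
    exact ⟨Q.add_mem ha hb, by rw [neg_add]; exact Q.add_mem ha' hb'⟩

/-- The *dimension of a face `F` of `Q`: `rank gp(F) - rank gp(F₀)`. -/
noncomputable def sdim {N : ℕ} (Q F : AddSubmonoid (ZN N)) : ℕ :=
  rk (gp F) - rk (gp (unitsFace Q))

/-- The *dimension of `Q`: `rank gp(Q) - rank gp(F₀)`. -/
noncomputable def sdimQ {N : ℕ} (Q : AddSubmonoid (ZN N)) : ℕ :=
  rk (gp Q) - rk (gp (unitsFace Q))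

/-- `Q` is seminormal: `2q, 3q ∈ Q` implies `q ∈ Q` for `q ∈ gp(Q)`. -/
def Seminormal {N : ℕ} (Q : AddSubmonoid (ZN N)) : Prop :=
  ∀ q ∈ gp Q, (2 : ℕ) • q ∈ Q → (3 : ℕ) • q ∈ Q → q ∈ Q

/-- The canonical embedding `ℤ^N → ℚ^N`. -/
def toQ {N : ℕ} (x : ZN N) : Fin N → ℚ := fun i => (x i : ℚ)

/-- The `ℚ`-linear span of (the image in `ℚ^N` of) a submonoid `F` of `ℤ^N`. -/
def qspan {N : ℕ} (F : AddSubmonoid (ZN N)) : Submodule ℚ (Fin N → ℚ) :=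
  Submodule.span ℚ (toQ '' (F : Set (ZN N)))

/-- Every element of `gp(G)` is a difference of two elements of `G`. -/
theorem exists_add_eq_of_mem_gp {N : ℕ} {G : AddSubmonoid (ZN N)} {x : ZN N} (hx : x ∈ gp G) :
    ∃ a ∈ G, ∃ b ∈ G, x + b = a := by
  induction hx using AddSubgroup.closure_induction with
  | mem x hx => exact ⟨x, hx, 0, G.zero_mem, add_zero x⟩
  | zero => exact ⟨0, G.zero_mem, 0, G.zero_mem, add_zero 0⟩
  | add x y _ _ ihx ihy =>
    obtain ⟨a, ha, b, hb, h₁⟩ := ihx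
    obtain ⟨c, hc, d, hd, h₂⟩ := ihy
    exact ⟨a + c, G.add_mem ha hc, b + d, G.add_mem hb hd, by rw [← h₁, ← h₂]; abel⟩
  | neg x _ ih =>
    obtain ⟨a, ha, b, hb, h⟩ := ih
    exact ⟨b, hb, a, ha, by rw [← h]; abel⟩

/-- A face `G` of `Q` satisfies `gp(G) ∩ Q ⊆ G`. -/
theorem IsFace.mem_of_mem_gp {N : ℕ} {Q G : AddSubmonoid (ZN N)} (hG : IsFace Q G) {x : ZN N}
    (hxQ : x ∈ Q) (hx : x ∈ gp G) : x ∈ G := by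
  obtain ⟨a, ha, b, hb, h⟩ := exists_add_eq_of_mem_gp hx
  exact ((hG.2 x b hxQ (hG.1 hb)).1 (h ▸ ha)).1

theorem IsFace.mem_of_nsmul_mem {N : ℕ} {Q G : AddSubmonoid (ZN N)} (hG : IsFace Q G) {x : ZN N}
    (hxQ : x ∈ Q) {n : ℕ} (hn : n ≠ 0) (hx : n • x ∈ G) : x ∈ G := by
  obtain ⟨m, rfl⟩ := Nat.exists_eq_succ_of_ne_zero hn
  rw [succ_nsmul] at hx
  exact ((hG.2 _ x (Q.nsmul_mem hxQ m) hxQ).1 hx).2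

/-- A submonoid `F` of `Q` has an element lying in none of finitely many faces of `Q`
except those containing `F`. -/
theorem exists_mem_forall_face_le {N : ℕ} {Q F : AddSubmonoid (ZN N)} (hF : F ≤ Q)
    {ι : Type*} [Fintype ι] {G : ι → AddSubmonoid (ZN N)} (hG : ∀ i, IsFace Q (G i)) :
    ∃ f ∈ F, ∀ i, f ∈ G i → F ≤ G i := by
  classical
  have key : ∀ i, ∃ f ∈ F, f ∈ G i → F ≤ G i := fun i => by
    by_cases hi : F ≤ G i
    · exact ⟨0, F.zero_mem, fun _ => hi⟩
    · obtain ⟨f, hf, hfG⟩ := SetLike.not_le_iff_exists.1 hi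
      exact ⟨f, hf, fun h => absurd h hfG⟩
  choose f hf hfG using key
  refine ⟨∑ i, f i, F.sum_mem fun i _ => hf i, fun i hi => hfG i ?_⟩
  rw [← Finset.add_sum_erase _ f (Finset.mem_univ i)] at hi
  exact (((hG i).2 _ _ (hF (hf i)) (Q.sum_mem fun j _ => hF (hf j))).1 hi).1

/-- If `F + q` is contained in a finite union of sets `gp(Gᵢ) + pᵢ`,
then it is contained in one of them. -/
theorem face_translate_subset_of_subset_union {N : ℕ} (Q : AddSubmonoid (ZN N))
    (hQ : Q.FG) (q : ZN N) (l : ℕ) (p : Fin l → ZN N)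
    (F : AddSubmonoid (ZN N)) (G : Fin l → AddSubmonoid (ZN N))
    (hq : q ∈ gp Q) (hp : ∀ i, p i ∈ gp Q)
    (hF : IsFace Q F) (hG : ∀ i, IsFace Q (G i))
    (h : (fun f => f + q) '' (F : Set (ZN N)) ⊆
      ⋃ i, (fun f => f + p i) '' (gp (G i) : Set (ZN N))) :
    ∃ i, (fun f => f + q) '' (F : Set (ZN N)) ⊆
      (fun f => f + p i) '' (gp (G i) : Set (ZN N)) := by
  obtain ⟨f, hf, hfG⟩ := exists_mem_forall_face_le hF.1 hG
  have cover : ∀ x ∈ F, ∃ i, x + q - p i ∈ gp (G i) := fun x hx => by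
    obtain ⟨i, g, hg, hgx⟩ := Set.mem_iUnion.1 (h ⟨x, hx, rfl⟩)
    exact ⟨i, by rwa [← eq_sub_of_add_eq hgx]⟩
  choose c hc using fun k : ℕ => cover (k • f) (F.nsmul_mem hf k)
  obtain ⟨m, n, hmn, hcmn⟩ : ∃ m n, m < n ∧ c m = c n := by
    obtain ⟨m, n, hne, heq⟩ := Finite.exists_ne_map_eq_of_infinite c
    rcases hne.lt_or_gt with hlt | hlt
    exacts [⟨m, n, hlt, heq⟩, ⟨n, m, hlt, heq.symm⟩]
  have hdiff : (n - m) • f ∈ gp (G (c m)) := by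
    have hsub := (gp (G (c m))).sub_mem (hcmn ▸ hc n) (hc m)
    rwa [sub_sub_sub_cancel_right, add_sub_add_right_eq_sub, sub_eq_iff_eq_add.2
      (by rw [← add_nsmul, Nat.sub_add_cancel hmn.le] : n • f = (n - m) • f + m • f)] at hsub
  have hle : F ≤ G (c m) := hfG _ <| (hG _).mem_of_nsmul_mem (hF.1 hf) (Nat.sub_ne_zero_of_lt hmn)
    ((hG _).mem_of_mem_gp (Q.nsmul_mem (hF.1 hf) _) hdiff)
  have hgp : ∀ x ∈ F, x ∈ gp (G (c m)) := fun x hx => AddSubgroup.subset_closure (hle hx)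
  refine ⟨c m, ?_⟩
  rintro _ ⟨x, hx, rfl⟩
  refine ⟨x - m • f + (m • f + q - p (c m)), (gp _).add_mem ((gp _).sub_mem (hgp x hx)
    (hgp _ (F.nsmul_mem hf m))) (hc m), ?_⟩
  dsimp only
  abel
end

section
/- Let Q be an affine monoid and F a face of Q. Then the localization Q_F is normal (i.e., Q_F = {q ∈ gp(Q) : n•q ∈ Q_F for some integer n ≥ 1}) if and only if there is no element s ∈ sat(Q) with F + s ⊆ sat(Q)∖Q. -/
open scoped Pointwise

theorem le_loc {N : ℕ} (Q F : AddSubmonoid (ZN N)) : Q ≤ loc Q F := fun q hq =>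
  ⟨q, hq, 0, F.zero_mem, by simp⟩

theorem gp_loc {N : ℕ} {Q F : AddSubmonoid (ZN N)} (hFQ : F ≤ Q) : gp (loc Q F) = gp Q := by
  apply le_antisymm
  · refine (AddSubgroup.closure_le _).mpr ?_
    rintro x ⟨q, hq, f, hf, rfl⟩
    exact (gp Q).sub_mem (AddSubgroup.subset_closure hq) (AddSubgroup.subset_closure (hFQ hf))
  · exact AddSubgroup.closure_mono (le_loc Q F)

theorem sat_mono {N : ℕ} {Q R : AddSubmonoid (ZN N)} (h : Q ≤ R) : sat Q ≤ sat R := by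
  rintro x ⟨hx, n, hn, hnx⟩
  exact ⟨AddSubgroup.closure_mono h hx, n, hn, h hnx⟩

/-- Every element of the normalization of `Q_F` is moved into `sat Q` by an element of `F`. -/
theorem exists_add_mem_sat_of_mem_sat_loc {N : ℕ} {Q F : AddSubmonoid (ZN N)} (hFQ : F ≤ Q)
    {x : ZN N} (hx : x ∈ sat (loc Q F)) : ∃ f ∈ F, x + f ∈ sat Q := by
  obtain ⟨hxg, n, hn, q, hq, f, hf, hnx⟩ := hx
  rw [gp_loc hFQ] at hxg
  refine ⟨f, hf, (gp Q).add_mem hxg (AddSubgroup.subset_closure (hFQ hf)), n, hn, ?_⟩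
  obtain ⟨k, rfl⟩ := Nat.exists_eq_add_of_le' hn
  have h : (k + 1) • (x + f) = q + k • f := by
    rw [smul_add, hnx, succ_nsmul]
    abel
  rw [h]
  exact Q.add_mem hq (Q.nsmul_mem (hFQ hf) k)

/-- The localization `Q_F` is normal if and only if there is no
`s ∈ sat(Q)` with `F + s ⊆ sat(Q) ∖ Q`. -/
theorem loc_normal_iff {N : ℕ} (Q F : AddSubmonoid (ZN N)) (hQ : Q.FG) (hF : IsFace Q F) :
    loc Q F = sat (loc Q F) ↔ ¬ ∃ s ∈ sat Q, ∀ f ∈ F, f + s ∈ holes Q := by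
  constructor
  · rintro h ⟨s, hs, hsF⟩
    have hsl : s ∈ loc Q F := h ▸ sat_mono (le_loc Q F) hs
    obtain ⟨q, hq, f, hf, rfl⟩ := hsl
    exact (hsF f hf).2 (by simpa using hq)
  · intro h
    refine le_antisymm (le_sat _) fun x hx => ?_
    obtain ⟨f, hf, hs⟩ := exists_add_mem_sat_of_mem_sat_loc hF.1 hx
    by_contra hxl
    refine h ⟨x + f, hs, fun g hg => ⟨(sat Q).add_mem (le_sat Q (hF.1 hg)) hs, fun hQ' => ?_⟩⟩
    exact hxl ⟨g + (x + f), hQ', g + f, F.add_mem hg hf, by abel⟩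
end

section
/- Let Q be an affine monoid. Then Q is seminormal if and only if for every family of holes gp(F) + q of Q (with q ∈ sat(Q)∖Q and F a face of Q maximal among faces G with G + q ⊆ sat(Q)∖Q), the element q lies in the ℚ-linear span of F inside ℚ^N. -/
open scoped Pointwise

/-- In a seminormal monoid, an element all of whose large multiples lie in `Q` lies in `Q`. -/
theorem Seminormal.mem_of_forall_ge {N : ℕ} {Q : AddSubmonoid (ZN N)} (hs : Seminormal Q)
    {x : ZN N} (hx : x ∈ gp Q) (M : ℕ) (h : ∀ t, M ≤ t → t • x ∈ Q) : x ∈ Q := by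
  induction M with
  | zero => simpa using h 1 (by omega)
  | succ M ih =>
    rcases Nat.eq_zero_or_pos M with rfl | hM
    · simpa using h 1 (by omega)
    refine ih fun t ht => ?_
    refine hs _ ((gp Q).nsmul_mem hx t) ?_ ?_
    · rw [← mul_nsmul']; exact h _ (by omega)
    · rw [← mul_nsmul']; exact h _ (by omega)

/-- The smallest face of `Q` containing the submonoid `F` and the element `p` of `Q`. -/
def faceAdjoin {N : ℕ} (Q F : AddSubmonoid (ZN N)) (p : ZN N) : AddSubmonoid (ZN N) where
  carrier := {x | x ∈ Q ∧ ∃ y ∈ Q, ∃ f ∈ F, ∃ k : ℕ, x + y = f + k • p}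
  zero_mem' := ⟨Q.zero_mem, 0, Q.zero_mem, 0, F.zero_mem, 0, by simp⟩
  add_mem' := by
    rintro a b ⟨ha, y, hy, f, hf, k, e⟩ ⟨hb, y', hy', f', hf', k', e'⟩
    refine ⟨Q.add_mem ha hb, y + y', Q.add_mem hy hy', f + f', F.add_mem hf hf', k + k', ?_⟩
    rw [add_add_add_comm, e, e', add_nsmul, add_add_add_comm]

theorem isFace_faceAdjoin {N : ℕ} (Q F : AddSubmonoid (ZN N)) (p : ZN N) :
    IsFace Q (faceAdjoin Q F p) := by
  refine ⟨fun x hx => hx.1, fun a b ha hb => ⟨?_, fun h => AddSubmonoid.add_mem _ h.1 h.2⟩⟩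
  rintro ⟨-, y, hy, f, hf, k, e⟩
  exact ⟨⟨ha, b + y, Q.add_mem hb hy, f, hf, k, by rw [← e, add_assoc]⟩,
    ⟨hb, a + y, Q.add_mem ha hy, f, hf, k, by rw [← e]; abel⟩⟩

theorem le_faceAdjoin {N : ℕ} {Q F : AddSubmonoid (ZN N)} (hF : F ≤ Q) (p : ZN N) :
    F ≤ faceAdjoin Q F p := fun f hf =>
  ⟨hF hf, 0, Q.zero_mem, f, hf, 0, by simp⟩

theorem mem_faceAdjoin {N : ℕ} {Q : AddSubmonoid (ZN N)} (F : AddSubmonoid (ZN N)) {p : ZN N}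
    (hp : p ∈ Q) : p ∈ faceAdjoin Q F p :=
  ⟨hp, 0, Q.zero_mem, 0, F.zero_mem, 1, by simp⟩

/-- If `f + m • q` and `f + (m + 1) • q` lie in `Q`, so do all large multiples of `f + q`. -/
theorem nsmul_add_mem_of_consecutive {N : ℕ} {Q : AddSubmonoid (ZN N)} {f q : ZN N} {m : ℕ}
    (hm : 1 ≤ m) (hf : f ∈ Q) (h0 : f + m • q ∈ Q) (h1 : f + (m + 1) • q ∈ Q) (t : ℕ)
    (ht : m * m ≤ t) : t • (f + q) ∈ Q := by
  have hr : m ≤ t / m := (Nat.le_div_iff_mul_le hm).2 ht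
  have hj : t % m < m := Nat.mod_lt _ hm
  have hle : t / m ≤ t := Nat.div_le_self _ _
  have hdiv : m * (t / m) + t % m = t := Nat.div_add_mod t m
  generalize t / m = r at *
  generalize t % m = j at *
  obtain ⟨d, rfl⟩ := Nat.exists_eq_add_of_le (hj.le.trans hr)
  obtain ⟨e, rfl⟩ := Nat.exists_eq_add_of_le hle
  have key : (j + d + e) • (f + q) = j • (f + (m + 1) • q) + d • (f + m • q) + e • f := by
    have hq : (j + d + e) • q = (m * (j + d) + j) • q := by rw [hdiv]
    rw [nsmul_add, hq]
    module
  rw [key]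
  exact Q.add_mem (Q.add_mem (Q.nsmul_mem h1 _) (Q.nsmul_mem h0 _)) (Q.nsmul_mem hf _)

theorem toQ_add {N : ℕ} (x y : ZN N) : toQ (x + y) = toQ x + toQ y := by
  ext i; simp [toQ]

theorem toQ_nsmul {N : ℕ} (n : ℕ) (x : ZN N) : toQ (n • x) = (n : ℚ) • toQ x := by
  ext i; simp [toQ]

theorem toQ_zsmul {N : ℕ} (n : ℤ) (x : ZN N) : toQ (n • x) = (n : ℚ) • toQ x := by
  ext i; simp [toQ]

theorem toQ_injective {N : ℕ} : Function.Injective (toQ (N := N)) := fun x y h => by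
  ext i
  exact Int.cast_injective (congrFun h i)

theorem toQ_mem_qspan_of_nsmul_mem {N : ℕ} {F : AddSubmonoid (ZN N)} {q : ZN N} {n : ℕ}
    (hn : 1 ≤ n) (h : n • q ∈ F) : toQ q ∈ qspan F := by
  have hn' : (n : ℚ) ≠ 0 := by positivity
  have := (qspan F).smul_mem (n : ℚ)⁻¹ (Submodule.subset_span ⟨_, h, rfl⟩)
  rwa [toQ_nsmul, inv_smul_smul₀ hn'] at this

theorem exists_smul_eq_toQ_of_mem_qspan {N : ℕ} {F : AddSubmonoid (ZN N)} {v : Fin N → ℚ}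
    (hv : v ∈ qspan F) : ∃ k : ℕ, 1 ≤ k ∧ ∃ x ∈ gp F, (k : ℚ) • v = toQ x := by
  induction hv using Submodule.span_induction with
  | mem v hv =>
    obtain ⟨x, hx, rfl⟩ := hv
    exact ⟨1, le_rfl, x, AddSubgroup.subset_closure hx, by simp⟩
  | zero => exact ⟨1, le_rfl, 0, (gp F).zero_mem, by ext i; simp [toQ]⟩
  | add v w _ _ hv hw =>
    obtain ⟨k, hk, x, hx, e⟩ := hv
    obtain ⟨l, hl, y, hy, e'⟩ := hw
    refine ⟨k * l, Nat.mul_pos hk hl, l • x + k • y,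
      (gp F).add_mem ((gp F).nsmul_mem hx _) ((gp F).nsmul_mem hy _), ?_⟩
    rw [toQ_add, toQ_nsmul, toQ_nsmul, ← e, ← e']
    push_cast
    module
  | smul a v _ hv =>
    obtain ⟨k, hk, x, hx, e⟩ := hv
    refine ⟨k * a.den, Nat.mul_pos hk a.den_pos, a.num • x, (gp F).zsmul_mem hx _, ?_⟩
    rw [toQ_zsmul, ← e, smul_smul, smul_smul]
    congr 1
    push_cast
    rw [mul_assoc, Rat.den_mul_eq_num, mul_comm]

theorem exists_sub_of_mem_gp {N : ℕ} {F : AddSubmonoid (ZN N)} {x : ZN N} (hx : x ∈ gp F) :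
    ∃ a ∈ F, ∃ b ∈ F, x + b = a := by
  induction hx using AddSubgroup.closure_induction with
  | mem x hx => exact ⟨x, hx, 0, F.zero_mem, by simp⟩
  | zero => exact ⟨0, F.zero_mem, 0, F.zero_mem, by simp⟩
  | add x y _ _ hx hy =>
    obtain ⟨a, ha, b, hb, rfl⟩ := hx
    obtain ⟨c, hc, d, hd, rfl⟩ := hy
    exact ⟨_, F.add_mem ha hc, _, F.add_mem hb hd, by abel⟩
  | neg x _ hx =>
    obtain ⟨a, ha, b, hb, rfl⟩ := hx
    exact ⟨b, hb, _, ha, by abel⟩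

/-- If `q` lies in the span of a face `F`, every multiple of `q` lying in `Q` lies in `F`. -/
theorem IsFace.nsmul_mem_of_toQ_mem_qspan {N : ℕ} {Q F : AddSubmonoid (ZN N)} (hF : IsFace Q F)
    {q : ZN N} (hq : toQ q ∈ qspan F) {n : ℕ} (hn : n • q ∈ Q) : n • q ∈ F := by
  obtain ⟨k, hk, x, hx, e⟩ := exists_smul_eq_toQ_of_mem_qspan hq
  obtain ⟨a, ha, b, hb, rfl⟩ := exists_sub_of_mem_gp hx
  rw [← toQ_nsmul] at e
  obtain rfl := toQ_injective e
  obtain ⟨k, rfl⟩ := Nat.exists_eq_add_of_le' hk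
  have h : n • q + (k • n • q + n • b) = n • ((k + 1) • q + b) := by module
  exact ((hF.2 _ _ hn (Q.add_mem (Q.nsmul_mem hn k) (Q.nsmul_mem (hF.1 hb) n))).1
    (h ▸ F.nsmul_mem ha n)).1

theorem isFace_unitsFace {N : ℕ} (Q : AddSubmonoid (ZN N)) : IsFace Q (unitsFace Q) := by
  refine ⟨fun x hx => hx.1, fun a b ha hb => ⟨fun h => ⟨⟨ha, ?_⟩, ⟨hb, ?_⟩⟩,
    fun h => AddSubmonoid.add_mem _ h.1 h.2⟩⟩
  · rw [show -a = -(a + b) + b by abel]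
    exact Q.add_mem h.2 hb
  · rw [show -b = -(a + b) + a by abel]
    exact Q.add_mem h.2 ha

theorem isFace_sSup {N : ℕ} {Q : AddSubmonoid (ZN N)} {c : Set (AddSubmonoid (ZN N))}
    (hne : c.Nonempty) (hc : IsChain (· ≤ ·) c) (h : ∀ F ∈ c, IsFace Q F) :
    IsFace Q (sSup c) := by
  refine ⟨sSup_le fun F hF => (h F hF).1, fun a b ha hb =>
    ⟨fun hab => ?_, fun hab => AddSubmonoid.add_mem _ hab.1 hab.2⟩⟩
  obtain ⟨F, hF, hab⟩ := (AddSubmonoid.mem_sSup_of_directedOn hne hc.directedOn).1 hab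
  have := ((h F hF).2 a b ha hb).1 hab
  exact ⟨le_sSup hF this.1, le_sSup hF this.2⟩

/-- Every hole is the base point of a family of holes. -/
theorem exists_isFamilyOfHolesWith {N : ℕ} {Q : AddSubmonoid (ZN N)} {q : ZN N}
    (hq : q ∈ holes Q) : ∃ F, IsFamilyOfHolesWith Q F q := by
  have hunits : ∀ u ∈ unitsFace Q, u + q ∈ holes Q := fun u hu =>
    ⟨(sat Q).add_mem (le_sat Q hu.1) hq.1, fun h => hq.2 (by simpa using Q.add_mem hu.2 h)⟩
  obtain ⟨F, -, hF⟩ := zorn_le_nonempty₀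
    {G : AddSubmonoid (ZN N) | IsFace Q G ∧ ∀ g ∈ G, g + q ∈ holes Q}
    (fun c hcs hc G hG => by
      refine ⟨sSup c, ⟨isFace_sSup ⟨G, hG⟩ hc fun F hF => (hcs hF).1, fun g hg => ?_⟩,
        fun _ => le_sSup⟩
      obtain ⟨F, hF, hgF⟩ := (AddSubmonoid.mem_sSup_of_directedOn ⟨G, hG⟩ hc.directedOn).1 hg
      exact (hcs hF).2 g hgF)
    (unitsFace Q) ⟨isFace_unitsFace Q, hunits⟩
  exact ⟨F, hq, hF.prop.1, hF.prop.2, fun G hG hGq hFG => le_antisymm (hF.2 ⟨hG, hGq⟩ hFG) hFG⟩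

/-- `Q` is seminormal iff for every family of holes `gp(F) + q` of `Q`,
the base point `q` lies in the `ℚ`-linear span of `F`. -/
theorem seminormal_iff_families_in_span {N : ℕ} (Q : AddSubmonoid (ZN N)) (hQ : Q.FG) :
    Seminormal Q ↔
      ∀ (q : ZN N) (F : AddSubmonoid (ZN N)),
        IsFamilyOfHolesWith Q F q → toQ q ∈ qspan F := by
  constructor
  · rintro hs q F ⟨hq, hF, hFq, hmax⟩
    obtain ⟨n, hn, hnq⟩ := hq.1.2
    by_contra hspan
    have hnot : ¬ ∀ g ∈ faceAdjoin Q F (n • q), g + q ∈ holes Q := fun h => by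
      have hG := hmax _ (isFace_faceAdjoin Q F (n • q)) h (le_faceAdjoin hF.1 _)
      exact hspan (toQ_mem_qspan_of_nsmul_mem hn (hG ▸ mem_faceAdjoin F hnq))
    push Not at hnot
    obtain ⟨g, ⟨hgQ, y, hy, f, hf, k, e⟩, hg⟩ := hnot
    have hgq : g + q ∈ Q := by
      by_contra h
      exact hg ⟨(sat Q).add_mem (le_sat Q hgQ) hq.1, h⟩
    have h0 : f + ((k + 1) * n) • q ∈ Q := by
      rw [mul_nsmul']
      exact Q.add_mem (hF.1 hf) (Q.nsmul_mem hnq _)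
    have h1 : f + ((k + 1) * n + 1) • q ∈ Q := by
      have : f + ((k + 1) * n + 1) • q = (g + q) + y + n • q := by
        rw [show (g + q) + y + n • q = (g + y) + q + n • q by abel, e]
        module
      rw [this]
      exact Q.add_mem (Q.add_mem hgq hy) hnq
    exact (hFq f hf).2 (hs.mem_of_forall_ge (hFq f hf).1.1 _
      (nsmul_add_mem_of_consecutive (Nat.mul_pos k.succ_pos hn) (hF.1 hf) h0 h1))
  · intro h q hq h2 h3
    by_contra hqQ
    obtain ⟨F, hF⟩ := exists_isFamilyOfHolesWith (Q := Q) ⟨⟨hq, 2, by omega, h2⟩, hqQ⟩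
    have := hF.2.2.1 _ (hF.2.1.nsmul_mem_of_toQ_mem_qspan (h q F hF) h2)
    exact this.2 (by rwa [← succ_nsmul])
end
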